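/- The induced map P: H_o/I(φ+Ψ₁)_o → 𝓗_o/𝓘(φ+φ₁+Ψ₁)_o, P([f_o]):=P̃(f_o), is an O_{ℂⁿ,o}-module isomorphism, and its inverse is the map Q: 𝓗_o/𝓘(φ+φ₁+Ψ₁)_o → H_o/I(φ+Ψ₁)_o given by Q([(F̃,o)])=[(F̃/F²)_o]. -/

import Mathlib

open MeasureTheory Set Filter Topology
open scoped ENNReal NNReal

noncomputable section

namespace GMY

/-- Extended exponential `e^x` for `x : EReal`, valued in `[0,∞]`. -/
def expE (x : EReal) : ℝ≥0∞ :=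
  if x = ⊤ then ⊤ else if x = ⊥ then 0 else ENNReal.ofReal (Real.exp x.toReal)

/-- Extended logarithm of a real number (`-∞` for nonpositive arguments). -/
def elog (r : ℝ) : EReal := if r ≤ 0 then (⊥ : EReal) else ((Real.log r : ℝ) : EReal)

/-- Positive part of an extended real, as an element of `[0,∞]`. -/
def posE (x : EReal) : ℝ≥0∞ := if x = ⊤ then ⊤ else ENNReal.ofReal x.toReal

/-- The sub-mean-value inequality `2π · c ≤ ∫₀^{2π} u(θ) dθ` for an `EReal`-valued
integrand, the possibly infinite integral being interpreted via positive and negative parts. -/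
def SubMeanIneq (u : ℝ → EReal) (c : EReal) : Prop :=
  ((2 * Real.pi : ℝ) : EReal) * c ≤
    ((∫⁻ θ in Set.Ioc (0:ℝ) (2 * Real.pi), posE (u θ) : ℝ≥0∞) : EReal)
      - ((∫⁻ θ in Set.Ioc (0:ℝ) (2 * Real.pi), posE (-(u θ)) : ℝ≥0∞) : EReal)

variable (n : ℕ)

/-- `ℂⁿ`. -/
abbrev Cn (n : ℕ) := EuclideanSpace ℂ (Fin n)

/-- Holomorphic on a subset of `ℂⁿ`. -/
def HoloB (f : Cn n → ℂ) (s : Set (Cn n)) : Prop := DifferentiableOn ℂ f s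

/-- An `EReal`-valued function on `ℂⁿ` is plurisubharmonic on a set: upper semicontinuous
and satisfying the sub-mean-value inequality along every holomorphic disc. -/
def PSHB (u : Cn n → EReal) (s : Set (Cn n)) : Prop :=
  UpperSemicontinuousOn u s ∧
  ∀ g : ℂ → Cn n, Differentiable ℂ g →
    ∀ r : ℝ, 0 < r → (∀ w : ℂ, ‖w‖ ≤ r → g w ∈ s) →
      SubMeanIneq (fun θ => u (g ((r : ℂ) * Complex.exp (θ * Complex.I)))) (u (g 0))

/-- A pseudoconvex domain in `ℂⁿ`: an open connected set admitting a continuous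
plurisubharmonic exhaustion function. -/
def IsPseudoconvexDomain (D : Set (Cn n)) : Prop :=
  IsOpen D ∧ D.Nonempty ∧ IsConnected D ∧
  ∃ ρ : Cn n → ℝ, ContinuousOn ρ D ∧
    PSHB n (fun z => ((ρ z : ℝ) : EReal)) D ∧ ∀ cc : ℝ, IsCompact {z ∈ D | ρ z ≤ cc}

/-- An analytic subset of `D`: locally (in `D`) the common zero set of finitely many
holomorphic functions. -/
def IsAnalyticSubsetIn (D A : Set (Cn n)) : Prop :=
  ∀ z ∈ D, ∃ U ∈ 𝓝 z, ∃ (k : ℕ) (g : Fin k → Cn n → ℂ),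
    (∀ i, HoloB n (g i) U) ∧ A ∩ U = {w ∈ U | ∀ i, g i w = 0}

/-- `Ψ = min (ψ - 2 log |F|, -T)`, set to `-T` at zeros of `F`. -/
def PsiOf {α : Type*} (ψ : α → EReal) (F : α → ℂ) (T : EReal) : α → EReal := fun z =>
  if F z = 0 then -T else min (ψ z - (2 : EReal) * elog ‖F z‖) (-T)

/-- `φ₁ = 2 max (ψ + T₁, 2 log |F|)`. -/
def phi1 (ψ : Cn n → EReal) (F : Cn n → ℂ) (T₁ : ℝ) : Cn n → EReal := fun z =>
  (2 : EReal) * max (ψ z + (T₁ : EReal)) ((2 : EReal) * elog ‖F z‖)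

/-- The value of `c` at `+∞` (used to extend `c(-Ψ)` across `{Ψ = -∞}`). -/
def cInfty (c : ℝ → ℝ) : ℝ≥0∞ := Filter.limsup (fun t => ENNReal.ofReal (c t)) Filter.atTop

/-- `c(x)` for an extended real `x`. -/
def cE (c : ℝ → ℝ) (x : EReal) : ℝ≥0∞ :=
  if x = ⊤ then cInfty c else ENNReal.ofReal (c x.toReal)

/-- The integrand `|f|² e^{-φ} c(-Ψ)`. -/
def wt {α : Type*} (c : ℝ → ℝ) (φ : α → ℝ) (Ψ : α → EReal) (f : α → ℂ) (z : α) : ℝ≥0∞ :=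
  (‖f z‖₊ : ℝ≥0∞) ^ 2 * ENNReal.ofReal (Real.exp (-φ z)) * cE c (-(Ψ z))

/-- Two functions define the same germ in `J(Ψ)_{z₀}`. -/
def GermEq {α : Type*} [TopologicalSpace α] (Ψ : α → EReal) (z₀ : α) (f g : α → ℂ) :
    Prop :=
  ∃ t : ℝ, ∃ V ∈ 𝓝 z₀, ∀ z ∈ V, Ψ z < -(t : EReal) → f z = g z

variable [MeasurableSpace (EuclideanSpace ℂ (Fin n))]
variable (D : Set (Cn n)) (F : Cn n → ℂ) (ψ : Cn n → EReal) (φ : Cn n → ℝ)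
  (T : EReal) (T₁ : ℝ) (c : ℝ → ℝ) (μ : Measure (Cn n))

/-- The class `P̃_{T,D,Ψ}` of gain functions (on a pseudoconvex domain `D ⊆ ℂⁿ`). -/
structure MemPTildeB (Ψ : Cn n → EReal) : Prop where
  measurable : Measurable c
  pos : ∀ t : ℝ, T < (t : EReal) → 0 < c t
  mono : ∀ s t : ℝ, T < (s : EReal) → s ≤ t → c t * Real.exp (-t) ≤ c s * Real.exp (-s)
  lower : ∀ t₀ : ℝ, T < (t₀ : EReal) → ∃ E₀ A : Set (Cn n), IsClosed E₀ ∧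
    E₀ ⊆ {z | Ψ z = ⊥} ∧ E₀ ⊆ A ∧ IsAnalyticSubsetIn n D A ∧
    ∀ K : Set (Cn n), IsCompact K → K ⊆ D \ E₀ → ∃ C : ℝ≥0∞, 0 < C ∧
      ∀ z ∈ K, Ψ z < -(t₀ : EReal) →
        C ≤ ENNReal.ofReal (Real.exp (-φ z)) * cE c (-(Ψ z))

/-- `f_o ∈ H_o`: `f` is holomorphic on `{Ψ < -t} ∩ V₀` for some `t > T` and neighborhood
`V₀` of the origin, with finite weighted `L²` norm there. -/
def MemHB (f : Cn n → ℂ) : Prop :=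
  ∃ t : ℝ, T < (t : EReal) ∧ ∃ V₀ ∈ 𝓝 (0 : Cn n), V₀ ⊆ D ∧
    HoloB n f ({z | PsiOf ψ F T z < -(t : EReal)} ∩ V₀) ∧
    (∫⁻ z in {z | PsiOf ψ F T z < -(t : EReal)} ∩ V₀,
      wt c φ (PsiOf ψ F T) f z ∂μ) < ⊤

/-- `(h,o) ∈ 𝓗_o`: `h` is holomorphic near the origin and
`∫ |h|² e^{-φ-φ₁} c(-Ψ₁) < +∞` near the origin. -/
def MemHHB (h : Cn n → ℂ) : Prop :=
  ∃ U₀ ∈ 𝓝 (0 : Cn n), U₀ ⊆ D ∧ HoloB n h U₀ ∧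
    (∫⁻ z in U₀, (‖h z‖₊ : ℝ≥0∞) ^ 2 * ENNReal.ofReal (Real.exp (-φ z))
      * expE (-(phi1 n ψ F T₁ z)) * cE c (-(PsiOf ψ F (T₁ : EReal) z)) ∂μ) < ⊤

/-- `(h,o)` belongs to the multiplier ideal `𝓘(Φ)_o`. -/
def MemMI (Φ : Cn n → EReal) (h : Cn n → ℂ) : Prop :=
  ∃ U ∈ 𝓝 (0 : Cn n), HoloB n h U ∧
    (∫⁻ z in U, (‖h z‖₊ : ℝ≥0∞) ^ 2 * expE (-(Φ z)) ∂μ) < ⊤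

/-- `f_o ∈ I(φ + Ψ')_o`, `Ψ' = Ψ` or `Ψ₁`: a germ (along the sublevel sets of `Ψ`)
which is holomorphic on `{Ψ < -t} ∩ V` with `∫ |f|² e^{-φ-Ψ'} < +∞` there. -/
def MemIo (Ψ' : Cn n → EReal) (f : Cn n → ℂ) : Prop :=
  ∃ t : ℝ, T < (t : EReal) ∧ ∃ V ∈ 𝓝 (0 : Cn n),
    HoloB n f ({z | PsiOf ψ F T z < -(t : EReal)} ∩ V) ∧
    (∫⁻ z in {z | PsiOf ψ F T z < -(t : EReal)} ∩ V,
      (‖f z‖₊ : ℝ≥0∞) ^ 2 * ENNReal.ofReal (Real.exp (-φ z))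
        * expE (-(Ψ' z)) ∂μ) < ⊤

/-- `P̃(f_o) = [(F̃,o)]`: the defining relation of the homomorphism `P̃`, namely
`(F̃,o) ∈ 𝓗_o` and `∫_{{Ψ₁<-t₁}∩D₁} |F̃ - f F²|² e^{-φ-φ₁-Ψ₁} < +∞` for some `t₁ > T₁`
and some neighborhood `D₁` of the origin. -/
def LinkedB (f Ftil : Cn n → ℂ) : Prop :=
  MemHHB n D F ψ φ T₁ c μ Ftil ∧ ∃ t₁ : ℝ, T₁ < t₁ ∧ ∃ D₁ ∈ 𝓝 (0 : Cn n),
    (∫⁻ z in {z | PsiOf ψ F (T₁ : EReal) z < -(t₁ : EReal)} ∩ D₁,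
      (‖Ftil z - f z * (F z) ^ 2‖₊ : ℝ≥0∞) ^ 2 * ENNReal.ofReal (Real.exp (-φ z))
        * expE (-(phi1 n ψ F T₁ z) - PsiOf ψ F (T₁ : EReal) z) ∂μ) < ⊤

/-- The full weight `φ + φ₁ + Ψ₁`. -/
def PhiFull : Cn n → EReal := fun z =>
  ((φ z : ℝ) : EReal) + phi1 n ψ F T₁ z + PsiOf ψ F (T₁ : EReal) z

section Exponentials

lemma expE_coe (a : ℝ) : expE (a : EReal) = ENNReal.ofReal (Real.exp a) := by
  simp [expE]

lemma expE_neg_coe_add (a : ℝ) (x : EReal) :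
    expE (-((a : EReal) + x)) = ENNReal.ofReal (Real.exp (-a)) * expE (-x) := by
  have hpos : ENNReal.ofReal (Real.exp (-a)) ≠ 0 := by
    simpa using Real.exp_pos (-a)
  induction x with
  | bot => simp [expE, ENNReal.mul_top hpos]
  | top => simp [expE]
  | coe b =>
    rw [← EReal.coe_add, ← EReal.coe_neg, ← EReal.coe_neg, expE_coe, expE_coe,
      ← ENNReal.ofReal_mul (Real.exp_pos _).le, ← Real.exp_add]
    congr 2
    ring

lemma elog_norm {w : ℂ} (hw : w ≠ 0) : elog ‖w‖ = ((Real.log ‖w‖ : ℝ) : EReal) := by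
  simp [elog, hw]

lemma expE_neg_four_log {w : ℂ} (hw : w ≠ 0) :
    expE (-((4 * Real.log ‖w‖ : ℝ) : EReal)) = ((‖w ^ 2‖₊ : ℝ≥0∞) ^ 2)⁻¹ := by
  have hpos : 0 < ‖w‖ := norm_pos_iff.mpr hw
  have h4 : Real.exp (4 * Real.log ‖w‖) = ‖w ^ 2‖ ^ 2 := by
    rw [norm_pow, ← pow_mul, show (4 : ℝ) * Real.log ‖w‖ = ((4 : ℕ) : ℝ) * Real.log ‖w‖ by norm_num,
      Real.exp_nat_mul, Real.exp_log hpos]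
  rw [← EReal.coe_neg, expE_coe, Real.exp_neg, h4,
    ENNReal.ofReal_inv_of_pos (h4 ▸ Real.exp_pos _), ENNReal.ofReal_pow (norm_nonneg _),
    ofReal_norm, enorm_eq_nnnorm]

lemma nnnorm_sq_mul_expE_neg_four_log (a : ℂ) {w : ℂ} (hw : w ≠ 0) :
    (‖a‖₊ : ℝ≥0∞) ^ 2 * expE (-((4 * Real.log ‖w‖ : ℝ) : EReal))
      = (‖a / w ^ 2‖₊ : ℝ≥0∞) ^ 2 := by
  have hw2 : ‖w ^ 2‖₊ ≠ 0 := by simpa using hw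
  rw [expE_neg_four_log hw, nnnorm_div, ENNReal.coe_div hw2, div_eq_mul_inv, mul_pow,
    ENNReal.inv_pow]

lemma nnnorm_sub_sq_le (a b : ℂ) (hab : ‖a‖ ≤ ‖b‖) :
    (‖a - b‖₊ : ℝ≥0∞) ^ 2 ≤ 4 * (‖b‖₊ : ℝ≥0∞) ^ 2 := by
  have h : ‖a - b‖₊ ≤ 2 * ‖b‖₊ := by
    rw [← NNReal.coe_le_coe]
    push_cast
    linarith [norm_sub_le a b]
  calc (‖a - b‖₊ : ℝ≥0∞) ^ 2 ≤ ((2 * ‖b‖₊ : ℝ≥0) : ℝ≥0∞) ^ 2 := by gcongr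
    _ = 4 * (‖b‖₊ : ℝ≥0∞) ^ 2 := by push_cast; ring

end Exponentials

section Sublevel

variable {α : Type*} {u : α → EReal} {G : α → ℂ} {S : EReal} {s t : ℝ} {z : α}

lemma PsiOf_lt_iff (hst : S ≤ (t : EReal)) :
    PsiOf u G S z < -(t : EReal) ↔
      G z ≠ 0 ∧ u z < ((-t + 2 * Real.log ‖G z‖ : ℝ) : EReal) := by
  have hS : ¬ -S < -(t : EReal) := not_lt.mpr (EReal.neg_le_neg_iff.mpr hst)
  by_cases h : G z = 0
  · simp [PsiOf, h, hS]
  · have hmul : (2 : EReal) * ((Real.log ‖G z‖ : ℝ) : EReal)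
        = ((2 * Real.log ‖G z‖ : ℝ) : EReal) := by norm_cast
    simp only [PsiOf, h, if_false, min_lt_iff, hS, or_false, ne_eq, not_false_eq_true, true_and,
      elog_norm h, hmul]
    rw [EReal.sub_lt_iff (.inl (EReal.coe_ne_bot _)) (.inl (EReal.coe_ne_top _))]
    norm_cast

lemma PsiOf_eq_sub (hst : S ≤ (t : EReal)) (hz : PsiOf u G S z < -(t : EReal)) :
    PsiOf u G S z = u z - 2 * elog ‖G z‖ := by
  have hG := ((PsiOf_lt_iff hst).mp hz).1
  have hS : ¬ -S < -(t : EReal) := not_lt.mpr (EReal.neg_le_neg_iff.mpr hst)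
  simp only [PsiOf, hG, if_false] at hz ⊢
  refine min_eq_left ?_
  by_contra hlt
  rw [min_eq_right (not_le.mp hlt).le] at hz
  exact hS hz

lemma PsiOf_eq_of_lt (hSs : S ≤ (s : EReal)) (hst : s ≤ t)
    (hz : PsiOf u G S z < -(t : EReal)) : PsiOf u G (s : EReal) z = PsiOf u G S z := by
  have hst' : (s : EReal) ≤ (t : EReal) := EReal.coe_le_coe_iff.mpr hst
  rw [PsiOf_eq_sub (hSs.trans hst') hz]
  refine PsiOf_eq_sub (t := t) hst' ?_
  rw [PsiOf_lt_iff hst']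
  exact (PsiOf_lt_iff (hSs.trans hst')).mp hz

lemma PsiOf_le_neg : PsiOf u G S z ≤ -S := by
  by_cases h : G z = 0 <;> simp [PsiOf, h]

lemma isOpen_PsiOf_lt_inter [TopologicalSpace α] {E U : Set α} (hu : UpperSemicontinuousOn u E)
    (hG : ContinuousOn G E) (hU : IsOpen U) (hUE : U ⊆ E) (hst : S ≤ (t : EReal)) :
    IsOpen ({z | PsiOf u G S z < -(t : EReal)} ∩ U) := by
  rw [isOpen_iff_mem_nhds]
  rintro x ⟨hx, hxU⟩
  have hEx : E ∈ 𝓝 x := mem_of_superset (hU.mem_nhds hxU) hUE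
  obtain ⟨hGx, hux⟩ := (PsiOf_lt_iff hst).mp hx
  obtain ⟨q, huq, hqG⟩ := EReal.exists_rat_btwn_of_lt hux
  have hGc : ContinuousAt G x := hG.continuousAt hEx
  have hlog : ContinuousAt (fun z => -t + 2 * Real.log ‖G z‖) x :=
    continuousAt_const.add (continuousAt_const.mul (hGc.norm.log (by simpa using hGx)))
  have h1 : ∀ᶠ z in 𝓝 x, u z < ((q : ℝ) : EReal) := by
    have := hu x (hUE hxU) _ huq
    rwa [nhdsWithin_eq_nhds.mpr hEx] at this
  have h2 : ∀ᶠ z in 𝓝 x, (q : ℝ) < -t + 2 * Real.log ‖G z‖ :=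
    hlog.eventually (lt_mem_nhds (EReal.coe_lt_coe_iff.mp hqG))
  filter_upwards [h1, h2, hGc.eventually_ne hGx, hU.mem_nhds hxU] with z hz1 hz2 hz3 hz4
  exact ⟨(PsiOf_lt_iff hst).mpr ⟨hz3, hz1.trans (EReal.coe_lt_coe_iff.mpr hz2)⟩, hz4⟩

lemma setLIntegral_lt_top_of_le_mul [MeasurableSpace α] {ν : Measure α} {A B : Set α}
    {f g : α → ℝ≥0∞} {C : ℝ≥0∞} (hA : MeasurableSet A) (hAB : A ⊆ B) (hC : C ≠ ⊤)
    (hfg : ∀ z ∈ A, f z ≤ C * g z) (hg : ∫⁻ z in B, g z ∂ν < ⊤) : ∫⁻ z in A, f z ∂ν < ⊤ :=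
  calc ∫⁻ z in A, f z ∂ν ≤ ∫⁻ z in A, C * g z ∂ν := setLIntegral_mono' hA hfg
    _ = C * ∫⁻ z in A, g z ∂ν := lintegral_const_mul' _ _ hC
    _ ≤ C * ∫⁻ z in B, g z ∂ν := by gcongr
    _ < ⊤ := ENNReal.mul_lt_top hC.lt_top hg

end Sublevel

section Weights

variable {n : ℕ} {D : Set (Cn n)} {F : Cn n → ℂ} {ψ : Cn n → EReal} {φ : Cn n → ℝ}
  {T : EReal} {T₁ t : ℝ} {c : ℝ → ℝ} {z : Cn n}

lemma phi1_eq_of_lt (ht : T₁ ≤ t) (hz : PsiOf ψ F (T₁ : EReal) z < -(t : EReal)) :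
    phi1 n ψ F T₁ z = ((4 * Real.log ‖F z‖ : ℝ) : EReal) := by
  obtain ⟨hFz, hlt⟩ := (PsiOf_lt_iff (EReal.coe_le_coe_iff.mpr ht)).mp hz
  have hle : ψ z + (T₁ : EReal) ≤ ((2 * Real.log ‖F z‖ : ℝ) : EReal) := by
    calc ψ z + (T₁ : EReal)
        ≤ ((-t + 2 * Real.log ‖F z‖ : ℝ) : EReal) + (T₁ : EReal) := by gcongr
      _ = ((-t + 2 * Real.log ‖F z‖ + T₁ : ℝ) : EReal) := by norm_cast
      _ ≤ _ := EReal.coe_le_coe_iff.mpr (by linarith)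
  have hmul : (2 : EReal) * ((Real.log ‖F z‖ : ℝ) : EReal)
      = ((2 * Real.log ‖F z‖ : ℝ) : EReal) := by norm_cast
  have hmul' : (2 : EReal) * ((2 * Real.log ‖F z‖ : ℝ) : EReal)
      = ((2 * (2 * Real.log ‖F z‖) : ℝ) : EReal) := by norm_cast
  rw [phi1, elog_norm hFz, hmul, max_eq_right hle, hmul']
  congr 1
  ring

lemma nnnorm_sq_mul_expE_neg_phi1 (a : ℂ) (ht : T₁ ≤ t)
    (hz : PsiOf ψ F (T₁ : EReal) z < -(t : EReal)) :
    (‖a‖₊ : ℝ≥0∞) ^ 2 * expE (-(phi1 n ψ F T₁ z)) = (‖a / F z ^ 2‖₊ : ℝ≥0∞) ^ 2 := by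
  rw [phi1_eq_of_lt ht hz]
  exact nnnorm_sq_mul_expE_neg_four_log a ((PsiOf_lt_iff (EReal.coe_le_coe_iff.mpr ht)).mp hz).1

lemma expE_neg_phi1_sub (ht : T₁ ≤ t) (hz : PsiOf ψ F (T₁ : EReal) z < -(t : EReal)) :
    expE (-(phi1 n ψ F T₁ z) - PsiOf ψ F (T₁ : EReal) z)
      = expE (-(phi1 n ψ F T₁ z)) * expE (-(PsiOf ψ F (T₁ : EReal) z)) := by
  rw [phi1_eq_of_lt ht hz, ← EReal.coe_neg, expE_coe, EReal.coe_neg, ← expE_neg_coe_add,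
    EReal.neg_add (.inl (EReal.coe_ne_bot _)) (.inl (EReal.coe_ne_top _))]

lemma expE_neg_PhiFull :
    expE (-(PhiFull n F ψ φ T₁ z)) = ENNReal.ofReal (Real.exp (-φ z))
      * expE (-(phi1 n ψ F T₁ z + PsiOf ψ F (T₁ : EReal) z)) := by
  rw [PhiFull, add_assoc, expE_neg_coe_add]

lemma expE_neg_phi1_add (ht : T₁ ≤ t) (hz : PsiOf ψ F (T₁ : EReal) z < -(t : EReal)) :
    expE (-(phi1 n ψ F T₁ z + PsiOf ψ F (T₁ : EReal) z))
      = expE (-(phi1 n ψ F T₁ z)) * expE (-(PsiOf ψ F (T₁ : EReal) z)) := by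
  rw [phi1_eq_of_lt ht hz, expE_neg_coe_add, ← EReal.coe_neg, expE_coe]

/-- Away from the deep sublevel sets of `Ψ₁`, the gain `c(-Ψ₁)` dominates `e^{-Ψ₁}`. -/
lemma expE_neg_PhiFull_le (hc : MemPTildeB n D φ T c (PsiOf ψ F T)) (hT₁ : T < (T₁ : EReal))
    (ht : T₁ ≤ t) (hz : ¬ PsiOf ψ F (T₁ : EReal) z < -(t : EReal)) :
    expE (-(PhiFull n F ψ φ T₁ z)) ≤ ENNReal.ofReal (Real.exp t / c t)
      * (ENNReal.ofReal (Real.exp (-φ z)) * expE (-(phi1 n ψ F T₁ z))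
        * cE c (-(PsiOf ψ F (T₁ : EReal) z))) := by
  have hle : PsiOf ψ F (T₁ : EReal) z ≤ -(T₁ : EReal) := PsiOf_le_neg
  have hge := not_lt.mp hz
  rw [expE_neg_PhiFull]
  generalize PsiOf ψ F (T₁ : EReal) z = p at hle hge
  rw [← EReal.coe_neg] at hle hge
  have hbot : p ≠ ⊥ := fun h => by simp [h] at hge
  have htop : p ≠ ⊤ := fun h => by simp [h] at hle
  lift p to ℝ using ⟨htop, hbot⟩
  rw [EReal.coe_le_coe_iff] at hle hge
  have hTp : T < ((-p : ℝ) : EReal) := hT₁.trans_le (EReal.coe_le_coe_iff.mpr (by linarith))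
  have hct : 0 < c t := hc.pos t (hT₁.trans_le (EReal.coe_le_coe_iff.mpr ht))
  have hmono := hc.mono (-p) t hTp (by linarith)
  have hexp : Real.exp (-p) ≤ Real.exp t / c t * c (-p) := by
    have h1 := mul_le_mul_of_nonneg_right hmono (Real.exp_pos (t - p)).le
    rw [mul_assoc, mul_assoc, ← Real.exp_add, ← Real.exp_add,
      show -t + (t - p) = -p by ring, show - -p + (t - p) = t by ring] at h1
    rw [div_mul_eq_mul_div, le_div_iff₀ hct]
    linarith
  have hcE : cE c (-(p : EReal)) = ENNReal.ofReal (c (-p)) := by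
    rw [← EReal.coe_neg]
    simp only [cE, EReal.coe_ne_top, if_false, EReal.toReal_coe]
  have hgain : ENNReal.ofReal (Real.exp (-p))
      ≤ ENNReal.ofReal (Real.exp t / c t) * ENNReal.ofReal (c (-p)) := by
    rw [← ENNReal.ofReal_mul (by positivity)]
    exact ENNReal.ofReal_le_ofReal hexp
  rw [add_comm, expE_neg_coe_add, hcE]
  calc _ = ENNReal.ofReal (Real.exp (-φ z)) * expE (-(phi1 n ψ F T₁ z))
        * ENNReal.ofReal (Real.exp (-p)) := by ring
    _ ≤ ENNReal.ofReal (Real.exp (-φ z)) * expE (-(phi1 n ψ F T₁ z))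
        * (ENNReal.ofReal (Real.exp t / c t) * ENNReal.ofReal (c (-p))) := by gcongr
    _ = _ := by ring

end Weights

/-- Proposition 2.6: the induced map `P : H_o/I(φ+Ψ₁)_o → 𝓗_o/𝓘(φ+φ₁+Ψ₁)_o`,
`P([f_o]) = P̃(f_o)`, is an `𝒪_{ℂⁿ,o}`-module isomorphism, with inverse the map `Q`
given by `Q([(F̃,o)]) = [(F̃/F²)_o]`: `Q` is well defined, `Q ∘ P = id` and
`P ∘ Q = id` (all statements being phrased on representatives, modulo `I(φ+Ψ₁)_o`
and `𝓘(φ+φ₁+Ψ₁)_o` respectively). -/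
theorem P_module_isomorphism_inverse_Q
    (n : ℕ) [MeasurableSpace (EuclideanSpace ℂ (Fin n))]
    [BorelSpace (EuclideanSpace ℂ (Fin n))]
    (μ : Measure (Cn n)) [μ.IsAddHaarMeasure]
    (D : Set (Cn n)) (hD : IsPseudoconvexDomain n D) (hoD : (0 : Cn n) ∈ D)
    (F : Cn n → ℂ) (hF : HoloB n F D) (hFne : ∃ z ∈ D, F z ≠ 0)
    (ψ : Cn n → EReal) (hψ : PSHB n ψ D)
    (φ : Cn n → ℝ) (hφ : Measurable φ)
    (hφψ : PSHB n (fun z => ((φ z : ℝ) : EReal) + ψ z) D)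
    (T : EReal) (hT : T ≠ ⊤) (T₁ : ℝ) (hT₁ : T < (T₁ : EReal))
    (c : ℝ → ℝ) (hc : MemPTildeB n D φ T c (PsiOf ψ F T))
    : -- `Q` is well defined on `𝓗_o` with values in `H_o`, and kills `𝓘(φ+φ₁+Ψ₁)_o`
    (∀ Ftil : Cn n → ℂ, MemHHB n D F ψ φ T₁ c μ Ftil →
      MemHB n D F ψ φ T c μ (fun z => Ftil z / (F z) ^ 2)) ∧
    (∀ Ftil : Cn n → ℂ, MemMI n μ (PhiFull n F ψ φ T₁) Ftil →
      MemIo n F ψ φ T μ (PsiOf ψ F (T₁ : EReal)) (fun z => Ftil z / (F z) ^ 2)) ∧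
    -- `Q ∘ P = id` on `H_o/I(φ+Ψ₁)_o`
    (∀ f Ftil : Cn n → ℂ, MemHB n D F ψ φ T c μ f →
      LinkedB n D F ψ φ T₁ c μ f Ftil →
      MemIo n F ψ φ T μ (PsiOf ψ F (T₁ : EReal)) ((fun z => Ftil z / (F z) ^ 2) - f)) ∧
    -- `P ∘ Q = id` on `𝓗_o/𝓘(φ+φ₁+Ψ₁)_o` (in particular `P` is surjective, and it is
    -- injective since its kernel is trivial)
    (∀ Ftil Gtil : Cn n → ℂ, MemHHB n D F ψ φ T₁ c μ Ftil →
      LinkedB n D F ψ φ T₁ c μ (fun z => Ftil z / (F z) ^ 2) Gtil →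
      MemMI n μ (PhiFull n F ψ φ T₁) (Gtil - Ftil)) := by
  have hDo : IsOpen D := hD.1
  have hFc : ContinuousOn F D := hF.continuousOn
  have hTT : T ≤ (T₁ : EReal) := hT₁.le
  have key : ∀ t : ℝ, T₁ ≤ t → ∀ z, PsiOf ψ F T z < -(t : EReal) →
      PsiOf ψ F (T₁ : EReal) z = PsiOf ψ F T z ∧ PsiOf ψ F (T₁ : EReal) z < -(t : EReal)
        ∧ F z ≠ 0 := by
    intro t ht z hz
    have h := PsiOf_eq_of_lt hTT ht hz
    exact ⟨h, h ▸ hz, ((PsiOf_lt_iff (hTT.trans (EReal.coe_le_coe_iff.mpr ht))).mp hz).1⟩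
  have hopen : ∀ t : ℝ, T₁ ≤ t → ∀ U : Set (Cn n), IsOpen U → U ⊆ D →
      IsOpen ({z | PsiOf ψ F T z < -(t : EReal)} ∩ U) := fun t ht U hU hUD =>
    isOpen_PsiOf_lt_inter hψ.1 hFc hU hUD (hTT.trans (EReal.coe_le_coe_iff.mpr ht))
  have hdiv : ∀ (t : ℝ), T₁ ≤ t → ∀ (h : Cn n → ℂ) (U : Set (Cn n)), HoloB n h U → U ⊆ D →
      HoloB n (fun z => h z / F z ^ 2) ({z | PsiOf ψ F T z < -(t : EReal)} ∩ U) := by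
    intro t ht h U hh hUD
    have hF' : DifferentiableOn ℂ F ({z | PsiOf ψ F T z < -(t : EReal)} ∩ U) :=
      DifferentiableOn.mono hF (inter_subset_right.trans hUD)
    simp only [HoloB, div_eq_mul_inv]
    exact (DifferentiableOn.mono hh inter_subset_right).fun_mul
      ((hF'.fun_pow 2).fun_inv fun z hz => pow_ne_zero 2 (key t ht z hz.1).2.2)
  refine ⟨?_, ?_, ?_, ?_⟩
  · rintro h ⟨U₀, hU₀, hU₀D, hh, hint⟩
    have hID : interior U₀ ⊆ D := interior_subset.trans hU₀D
    refine ⟨T₁, hT₁, interior U₀, interior_mem_nhds.mpr hU₀, hID,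
      hdiv T₁ le_rfl h _ (DifferentiableOn.mono hh interior_subset) hID, ?_⟩
    refine setLIntegral_lt_top_of_le_mul
      (hopen T₁ le_rfl _ isOpen_interior hID).measurableSet
      (inter_subset_right.trans interior_subset) ENNReal.one_ne_top ?_ hint
    intro z hz
    obtain ⟨heq, hlt, -⟩ := key T₁ le_rfl z hz.1
    rw [wt, ← nnnorm_sq_mul_expE_neg_phi1 (h z) le_rfl hlt, heq, one_mul]
    exact le_of_eq (by ring)
  · rintro h ⟨U, hU, hh, hint⟩
    have hID : interior U ∩ D ⊆ D := inter_subset_right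
    have hIU : interior U ∩ D ⊆ U := inter_subset_left.trans interior_subset
    refine ⟨T₁, hT₁, interior U ∩ D, inter_mem (interior_mem_nhds.mpr hU) (hDo.mem_nhds hoD),
      hdiv T₁ le_rfl h _ (DifferentiableOn.mono hh hIU) hID, ?_⟩
    refine setLIntegral_lt_top_of_le_mul
      (hopen T₁ le_rfl _ (isOpen_interior.inter hDo) hID).measurableSet
      (inter_subset_right.trans hIU) ENNReal.one_ne_top ?_ hint
    intro z hz
    obtain ⟨-, hlt, -⟩ := key T₁ le_rfl z hz.1
    rw [← nnnorm_sq_mul_expE_neg_phi1 (h z) le_rfl hlt, expE_neg_PhiFull,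
      expE_neg_phi1_add le_rfl hlt, one_mul]
    exact le_of_eq (by ring)
  · rintro f h ⟨t₀, -, V₀, hV₀, -, hf, -⟩
      ⟨⟨U₀, hU₀, hU₀D, hh, -⟩, t₁, ht₁, D₁, hD₁, hint⟩
    set t := max t₀ t₁
    have hT₁t : T₁ ≤ t := ht₁.le.trans (le_max_right _ _)
    set W := interior (U₀ ∩ V₀ ∩ D₁)
    have hWsub : W ⊆ U₀ ∩ V₀ ∩ D₁ := interior_subset
    have hWU : W ⊆ U₀ := fun z hz => (hWsub hz).1.1
    have hWD : W ⊆ D := hWU.trans hU₀D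
    have hle : ∀ s : ℝ, s ≤ t → -(t : EReal) ≤ -(s : EReal) := fun s hs =>
      EReal.neg_le_neg_iff.mpr (EReal.coe_le_coe_iff.mpr hs)
    refine ⟨t, hT₁.trans_le (EReal.coe_le_coe_iff.mpr hT₁t), W,
      interior_mem_nhds.mpr (inter_mem (inter_mem hU₀ hV₀) hD₁),
      (hdiv t hT₁t h W (DifferentiableOn.mono hh hWU) hWD).sub
        (DifferentiableOn.mono hf fun z hz =>
          ⟨lt_of_lt_of_le hz.1 (hle t₀ (le_max_left _ _)), (hWsub hz.2).1.2⟩), ?_⟩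
    have hWD₁ : {z | PsiOf ψ F T z < -(t : EReal)} ∩ W ⊆
        {z | PsiOf ψ F (T₁ : EReal) z < -(t₁ : EReal)} ∩ D₁ := fun z hz =>
      ⟨(key t hT₁t z hz.1).2.1.trans_le (hle t₁ (le_max_right _ _)), (hWsub hz.2).2⟩
    refine setLIntegral_lt_top_of_le_mul (hopen t hT₁t W isOpen_interior hWD).measurableSet
      hWD₁ ENNReal.one_ne_top ?_ hint
    intro z hz
    obtain ⟨-, hlt, hFz⟩ := key t hT₁t z hz.1
    have hsub : h z / F z ^ 2 - f z = (h z - f z * F z ^ 2) / F z ^ 2 := by field_simp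
    rw [Pi.sub_apply, hsub, ← nnnorm_sq_mul_expE_neg_phi1 _ hT₁t hlt,
      expE_neg_phi1_sub hT₁t hlt, one_mul]
    exact le_of_eq (by ring)
  · rintro h g ⟨U₀, hU₀, hU₀D, hh, hinth⟩ ⟨⟨U₁, hU₁, -, hg, hintg⟩, t₁, ht₁, D₁, hD₁, hint⟩
    set W := interior (U₀ ∩ U₁ ∩ D₁)
    have hWsub : W ⊆ U₀ ∩ U₁ ∩ D₁ := interior_subset
    have hWU₀ : W ⊆ U₀ := fun z hz => (hWsub hz).1.1
    have hWU₁ : W ⊆ U₁ := fun z hz => (hWsub hz).1.2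
    have hhW : DifferentiableOn ℂ h W := DifferentiableOn.mono hh hWU₀
    have hgW : DifferentiableOn ℂ g W := DifferentiableOn.mono hg hWU₁
    refine ⟨W, interior_mem_nhds.mpr (inter_mem (inter_mem hU₀ hU₁) hD₁), hgW.sub hhW, ?_⟩
    set S := {z | PsiOf ψ F (T₁ : EReal) z < -(t₁ : EReal)} ∩ W
    have hSm : MeasurableSet S := (isOpen_PsiOf_lt_inter hψ.1 hFc isOpen_interior
      (hWU₀.trans hU₀D) (EReal.coe_le_coe_iff.mpr ht₁.le)).measurableSet
    have hWm : MeasurableSet W := isOpen_interior.measurableSet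
    obtain ⟨R, hRm, hR⟩ : ∃ R : Set (Cn n), MeasurableSet R ∧
        ∀ z ∈ W, z ∈ R ↔ ‖h z‖ < ‖g z‖ := by
      obtain ⟨O, hO, hOW⟩ := (continuousOn_iff'.mp
        (hgW.continuousOn.norm.sub hhW.continuousOn.norm)) (Ioi 0) isOpen_Ioi
      refine ⟨O, hO.measurableSet, fun z hz => ?_⟩
      have hmem := Set.ext_iff.mp hOW z
      simp only [mem_inter_iff, mem_preimage, mem_Ioi, hz, and_true] at hmem
      rw [← hmem]
      exact sub_pos
    set K := ENNReal.ofReal (Real.exp t₁ / c t₁)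
    have hK : 4 * K ≠ ⊤ := ENNReal.mul_ne_top (by norm_num) ENNReal.ofReal_ne_top
    have hbound : ∀ (a b : ℂ) (z : Cn n), (‖a‖₊ : ℝ≥0∞) ^ 2 ≤ 4 * (‖b‖₊ : ℝ≥0∞) ^ 2 → z ∈ W \ S →
        (‖a‖₊ : ℝ≥0∞) ^ 2 * expE (-(PhiFull n F ψ φ T₁ z)) ≤ 4 * K *
          ((‖b‖₊ : ℝ≥0∞) ^ 2 * ENNReal.ofReal (Real.exp (-φ z)) * expE (-(phi1 n ψ F T₁ z))
            * cE c (-(PsiOf ψ F (T₁ : EReal) z))) := by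
      intro a b z hab hz
      refine (mul_le_mul' hab (expE_neg_PhiFull_le hc hT₁ ht₁.le
        fun hlt => hz.2 ⟨hlt, hz.1⟩)).trans (le_of_eq (by ring))
    have hdeep : ∫⁻ z in S, (‖(g - h) z‖₊ : ℝ≥0∞) ^ 2 * expE (-(PhiFull n F ψ φ T₁ z)) ∂μ < ⊤ := by
      refine setLIntegral_lt_top_of_le_mul hSm (inter_subset_inter_right _
        fun z hz => (hWsub hz).2) ENNReal.one_ne_top ?_ hint
      intro z hz
      have hFz : F z ≠ 0 := ((PsiOf_lt_iff (EReal.coe_le_coe_iff.mpr ht₁.le)).mp hz.1).1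
      rw [Pi.sub_apply, div_mul_cancel₀ _ (pow_ne_zero 2 hFz), expE_neg_PhiFull,
        expE_neg_phi1_add ht₁.le hz.1, expE_neg_phi1_sub ht₁.le hz.1, one_mul]
      exact le_of_eq (by ring)
    have hshallow_g : ∫⁻ z in (W \ S) ∩ R,
        (‖(g - h) z‖₊ : ℝ≥0∞) ^ 2 * expE (-(PhiFull n F ψ φ T₁ z)) ∂μ < ⊤ := by
      refine setLIntegral_lt_top_of_le_mul ((hWm.diff hSm).inter hRm)
        (fun z hz => hWU₁ hz.1.1) hK (fun z hz => hbound _ _ z ?_ hz.1) hintg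
      have hcomm : ‖(g - h) z‖₊ = ‖h z - g z‖₊ := NNReal.eq (norm_sub_rev (g z) (h z))
      rw [hcomm]
      exact nnnorm_sub_sq_le _ _ ((hR z hz.1.1).mp hz.2).le
    have hshallow_h : ∫⁻ z in (W \ S) \ R,
        (‖(g - h) z‖₊ : ℝ≥0∞) ^ 2 * expE (-(PhiFull n F ψ φ T₁ z)) ∂μ < ⊤ := by
      refine setLIntegral_lt_top_of_le_mul ((hWm.diff hSm).diff hRm)
        (fun z hz => hWU₀ hz.1.1) hK (fun z hz => hbound _ _ z ?_ hz.1) hinth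
      exact nnnorm_sub_sq_le _ _ (not_lt.mp fun hlt => hz.2 ((hR z hz.1.1).mpr hlt))
    have hcover : W ⊆ S ∪ ((W \ S) ∩ R ∪ (W \ S) \ R) := by
      rw [inter_union_sdiff, union_sdiff_self]
      exact subset_union_right
    calc _ ≤ _ := lintegral_mono_set hcover
      _ ≤ _ := lintegral_union_le _ _ _
      _ ≤ _ := add_le_add_right (lintegral_union_le _ _ _) _
      _ < ⊤ := ENNReal.add_lt_top.mpr ⟨hdeep, ENNReal.add_lt_top.mpr ⟨hshallow_g, hshallow_h⟩⟩

end GMY
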